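/- Let M be a commutative monoid and consider the monoid algebra ℤ[M]. For the multiplicative set S = {[m] : m ∈ M} ⊆ ℤ[M] of monomials, the localization S⁻¹ℤ[M] is naturally isomorphic as a ring to the group algebra ℤ[G(M)] of the Grothendieck group G(M) of M. -/

import Mathlib

variable (M : Type*) [AddCommMonoid M]

/-- The stable-equivalence relation on pairs: `(a,b) ∼ (c,d)` iff `∃ k, a + d + k = c + b + k`. -/
def grel (p q : M × M) : Prop := ∃ k, p.1 + q.2 + k = q.1 + p.2 + k

theorem grel_equivalence : Equivalence (grel M) := by
  constructor
  · exact fun p => ⟨0, rfl⟩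
  · rintro p q ⟨k, h⟩
    exact ⟨k, h.symm⟩
  · rintro p q r ⟨k, h⟩ ⟨l, h'⟩
    refine ⟨q.1 + q.2 + k + l, ?_⟩
    calc p.1 + r.2 + (q.1 + q.2 + k + l) = (p.1 + q.2 + k) + (q.1 + r.2 + l) := by ac_rfl
      _ = (q.1 + p.2 + k) + (r.1 + q.2 + l) := by rw [h, h']
      _ = r.1 + p.2 + (q.1 + q.2 + k + l) := by ac_rfl

instance grothSetoid : Setoid (M × M) := ⟨grel M, grel_equivalence M⟩

/-- The Grothendieck group of a commutative monoid, as pairs modulo stable equivalence. -/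
def Groth := Quotient (grothSetoid M)

instance : Add (Groth M) :=
  ⟨Quotient.map₂ (· + ·) (by
    rintro ⟨a, b⟩ ⟨c, d⟩ ⟨k, hk⟩ ⟨e, f⟩ ⟨g, i⟩ ⟨l, hl⟩
    refine ⟨k + l, ?_⟩
    show a + e + (d + i) + (k + l) = c + g + (b + f) + (k + l)
    calc a + e + (d + i) + (k + l) = (a + d + k) + (e + i + l) := by ac_rfl
      _ = (c + b + k) + (g + f + l) := by rw [hk, hl]
      _ = c + g + (b + f) + (k + l) := by ac_rfl)⟩

instance : Neg (Groth M) :=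
  ⟨Quotient.map Prod.swap (by
    rintro ⟨a, b⟩ ⟨c, d⟩ ⟨k, hk⟩
    refine ⟨k, ?_⟩
    show b + c + k = d + a + k
    calc b + c + k = c + b + k := by ac_rfl
      _ = a + d + k := hk.symm
      _ = d + a + k := by ac_rfl)⟩

instance : Zero (Groth M) := ⟨Quotient.mk (grothSetoid M) (0, 0)⟩

/-- The class of a pair in the Grothendieck group. -/
def Groth.mk (p : M × M) : Groth M := Quotient.mk (grothSetoid M) p

theorem Groth.mk_add (p q : M × M) :
    Groth.mk M p + Groth.mk M q = Groth.mk M (p + q) := rfl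

instance : AddCommGroup (Groth M) where
  add := (· + ·)
  zero := 0
  neg := Neg.neg
  nsmul := nsmulRec
  zsmul := zsmulRec
  add_assoc x y z := by
    obtain ⟨⟨a, b⟩, rfl⟩ := Quotient.exists_rep x
    obtain ⟨⟨c, d⟩, rfl⟩ := Quotient.exists_rep y
    obtain ⟨⟨e, f⟩, rfl⟩ := Quotient.exists_rep z
    refine Quotient.sound ⟨0, ?_⟩
    show a + c + e + (b + (d + f)) + 0 = a + (c + e) + (b + d + f) + 0
    ac_rfl
  zero_add x := by
    obtain ⟨⟨a, b⟩, rfl⟩ := Quotient.exists_rep x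
    refine Quotient.sound ⟨0, ?_⟩
    show 0 + a + b + 0 = a + (0 + b) + 0
    ac_rfl
  add_zero x := by
    obtain ⟨⟨a, b⟩, rfl⟩ := Quotient.exists_rep x
    refine Quotient.sound ⟨0, ?_⟩
    show a + 0 + b + 0 = a + (b + 0) + 0
    ac_rfl
  add_comm x y := by
    obtain ⟨⟨a, b⟩, rfl⟩ := Quotient.exists_rep x
    obtain ⟨⟨c, d⟩, rfl⟩ := Quotient.exists_rep y
    refine Quotient.sound ⟨0, ?_⟩
    show a + c + (d + b) + 0 = c + a + (b + d) + 0
    ac_rfl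
  neg_add_cancel x := by
    obtain ⟨⟨a, b⟩, rfl⟩ := Quotient.exists_rep x
    refine Quotient.sound ⟨0, ?_⟩
    show b + a + 0 + 0 = 0 + (a + b) + 0
    ac_rfl

/-- The canonical map `M → G(M)`, `a ↦ [(a,0)]`. -/
def grothMk : M → Groth M := fun a => Quotient.mk (grothSetoid M) (a, 0)

/-- The map on Grothendieck groups induced by a monoid homomorphism. -/
def grothMap {M N : Type*} [AddCommMonoid M] [AddCommMonoid N] (f : M →+ N) :
    Groth M → Groth N :=
  Quotient.map (Prod.map f f) (by
    rintro ⟨a, b⟩ ⟨c, d⟩ ⟨k, hk⟩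
    exact ⟨f k, by
      show f a + f d + f k = f c + f b + f k
      rw [← map_add, ← map_add, ← map_add, ← map_add, hk]⟩)

/-- The canonical map `M → G(M)` as an additive monoid homomorphism. -/
def grothMkHom : M →+ Groth M where
  toFun := grothMk M
  map_zero' := rfl
  map_add' a b := Quotient.sound ⟨0, by
    show a + b + (0 + 0) + 0 = a + b + 0 + 0
    simp⟩

theorem grothMkHom_apply (m : M) : grothMkHom M m = grothMk M m := rfl

theorem grothMk_sub_grothMk (a b : M) : grothMk M a - grothMk M b = Groth.mk M (a, b) := by
  rw [sub_eq_add_neg]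
  refine Quotient.sound ⟨0, ?_⟩
  show a + 0 + b + 0 = a + (0 + b) + 0
  ac_rfl

/-- The extension to `G(M)` of a homomorphism from `M` to a commutative group. -/
def grothLift {H : Type*} [AddCommGroup H] (f : M →+ H) : Groth M →+ H where
  toFun := Quotient.lift (fun p => f p.1 - f p.2) (by
    rintro ⟨a, b⟩ ⟨c, d⟩ ⟨k, hk⟩
    have h := congrArg f hk
    simp only [map_add, add_left_inj] at h
    exact sub_eq_sub_iff_add_eq_add.mpr h)
  map_zero' := sub_self (f 0)
  map_add' x y := by
    obtain ⟨⟨a, b⟩, rfl⟩ := Quotient.exists_rep x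
    obtain ⟨⟨c, d⟩, rfl⟩ := Quotient.exists_rep y
    show f (a + c) - f (b + d) = f a - f b + (f c - f d)
    rw [map_add, map_add, add_sub_add_comm]

theorem grothLift_grothMk {H : Type*} [AddCommGroup H] (f : M →+ H) (m : M) :
    grothLift M f (grothMk M m) = f m := by
  show f m - f 0 = f m
  simp

theorem groth_hom_ext {H : Type*} [AddCommGroup H] {f g : Groth M →+ H}
    (h : ∀ m, f (grothMk M m) = g (grothMk M m)) : f = g := by
  ext x
  obtain ⟨⟨a, b⟩, rfl⟩ := Quotient.exists_rep x
  show f (Groth.mk M (a, b)) = g (Groth.mk M (a, b))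
  rw [← grothMk_sub_grothMk, map_sub, map_sub, h, h]

/-- Two multiplicative maps from `G(M)` to a commutative monoid agree if they agree on `M`. -/
theorem groth_monoidHom_ext {A : Type*} [CommMonoid A] {f g : Multiplicative (Groth M) →* A}
    (h : ∀ m, f (.ofAdd (grothMk M m)) = g (.ofAdd (grothMk M m))) : f = g := by
  have key : MonoidHom.toAdditiveRight f.toHomUnits = MonoidHom.toAdditiveRight g.toHomUnits :=
    groth_hom_ext M fun m => Additive.toMul.injective (Units.ext (h m))
  ext x
  exact congrArg (fun u : Additive Aˣ => (u.toMul : A)) (DFunLike.congr_fun key (Multiplicative.toAdd x))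

/-- The monomials of `ℤ[M]` as units of the localization at the monomials. -/
noncomputable def monomialUnit :
    M →+ Additive (Localization (MonoidHom.mrange (AddMonoidAlgebra.of ℤ M)))ˣ :=
  MonoidHom.toAdditiveRight <|
    { toFun := fun m => (IsLocalization.map_units
        (Localization (MonoidHom.mrange (AddMonoidAlgebra.of ℤ M)))
        (⟨AddMonoidAlgebra.of ℤ M m, m, rfl⟩ :
          MonoidHom.mrange (AddMonoidAlgebra.of ℤ M))).unit
      map_one' := Units.ext (by
        show algebraMap _ _ (AddMonoidAlgebra.of ℤ M 1) = 1
        rw [map_one, map_one])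
      map_mul' := fun a b => Units.ext (by
        show algebraMap _ _ (AddMonoidAlgebra.of ℤ M (.ofAdd a * .ofAdd b)) =
          algebraMap _ _ (AddMonoidAlgebra.of ℤ M (.ofAdd a)) *
            algebraMap _ _ (AddMonoidAlgebra.of ℤ M (.ofAdd b))
        rw [map_mul, map_mul]) }

theorem coe_monomialUnit (m : M) :
    ((monomialUnit M m).toMul : Localization (MonoidHom.mrange (AddMonoidAlgebra.of ℤ M))) =
      algebraMap _ _ (AddMonoidAlgebra.of' ℤ M m) := rfl

/-- The ring homomorphism from `ℤ[M]` localized at the monomials to `ℤ[G(M)]`. -/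
noncomputable def localizationToGroupAlgebra :
    Localization (MonoidHom.mrange (AddMonoidAlgebra.of ℤ M)) →+*
      AddMonoidAlgebra ℤ (Groth M) :=
  IsLocalization.lift (M := MonoidHom.mrange (AddMonoidAlgebra.of ℤ M))
    (g := AddMonoidAlgebra.mapDomainRingHom ℤ (grothMkHom M)) (by
      rintro ⟨_, m, rfl⟩
      have h := (Group.isUnit (Multiplicative.ofAdd (grothMk M m.toAdd))).map
        (AddMonoidAlgebra.of ℤ (Groth M))
      simpa [AddMonoidAlgebra.of_apply, grothMkHom_apply] using h)

theorem localizationToGroupAlgebra_monomial (m : M) :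
    localizationToGroupAlgebra M (algebraMap _ _ (AddMonoidAlgebra.of' ℤ M m)) =
      AddMonoidAlgebra.of' ℤ (Groth M) (grothMk M m) := by
  simp [localizationToGroupAlgebra, AddMonoidAlgebra.of'_apply, grothMkHom_apply]

/-- The ring homomorphism from `ℤ[G(M)]` to `ℤ[M]` localized at the monomials. -/
noncomputable def groupAlgebraToLocalization :
    AddMonoidAlgebra ℤ (Groth M) →+*
      Localization (MonoidHom.mrange (AddMonoidAlgebra.of ℤ M)) :=
  (AddMonoidAlgebra.lift ℤ _ _ ((Units.coeHom _).comp
    (AddMonoidHom.toMultiplicativeLeft (grothLift M (monomialUnit M))))).toRingHom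

theorem groupAlgebraToLocalization_monomial (m : M) :
    groupAlgebraToLocalization M (AddMonoidAlgebra.of' ℤ (Groth M) (grothMk M m)) =
      algebraMap _ _ (AddMonoidAlgebra.of' ℤ M m) := by
  rw [← coe_monomialUnit, ← grothLift_grothMk M (monomialUnit M)]
  simp [groupAlgebraToLocalization, AddMonoidAlgebra.of'_apply]

theorem groupAlgebraToLocalization_comp :
    (groupAlgebraToLocalization M).comp (localizationToGroupAlgebra M) = RingHom.id _ := by
  refine IsLocalization.ringHom_ext (MonoidHom.mrange (AddMonoidAlgebra.of ℤ M)) ?_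
  refine AddMonoidAlgebra.ringHom_ext' (RingHom.ext_int _ _) (MonoidHom.ext fun m => ?_)
  show groupAlgebraToLocalization M (localizationToGroupAlgebra M
    (algebraMap _ _ (AddMonoidAlgebra.of' ℤ M m.toAdd))) =
      algebraMap _ _ (AddMonoidAlgebra.of' ℤ M m.toAdd)
  rw [localizationToGroupAlgebra_monomial, groupAlgebraToLocalization_monomial]

theorem localizationToGroupAlgebra_comp :
    (localizationToGroupAlgebra M).comp (groupAlgebraToLocalization M) = RingHom.id _ := by
  refine AddMonoidAlgebra.ringHom_ext' (RingHom.ext_int _ _) (groth_monoidHom_ext M fun m => ?_)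
  show localizationToGroupAlgebra M (groupAlgebraToLocalization M
    (AddMonoidAlgebra.of' ℤ (Groth M) (grothMk M m))) =
      AddMonoidAlgebra.of' ℤ (Groth M) (grothMk M m)
  rw [groupAlgebraToLocalization_monomial, localizationToGroupAlgebra_monomial]

open AddMonoidAlgebra in
/-- Localizing the monoid algebra `ℤ[M]` at the monomials gives the group algebra of the
Grothendieck group of `M`. -/
theorem statement10 :
    ∃ e : Localization (MonoidHom.mrange (AddMonoidAlgebra.of ℤ M)) ≃+* AddMonoidAlgebra ℤ (Groth M),
      ∀ m : M,
        e (algebraMap (AddMonoidAlgebra ℤ M) (Localization (MonoidHom.mrange (AddMonoidAlgebra.of ℤ M)))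
            (AddMonoidAlgebra.of' ℤ M m)) =
          AddMonoidAlgebra.of' ℤ (Groth M) (grothMk M m) := by
  exact ⟨RingEquiv.ofRingHom (localizationToGroupAlgebra M) (groupAlgebraToLocalization M)
    (localizationToGroupAlgebra_comp M) (groupAlgebraToLocalization_comp M),
    localizationToGroupAlgebra_monomial M⟩
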